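/- Let G be a hom-set strong small category and let S be an object unital G-graded ring. Then the following four properties are equivalent: (1) for all (a,b,c) ∈ G_0×G_0×G_0, if two of the additive groups S_{G(a,b)}, S_{G(b,c)}, S_{G(a,c)} are nonzero, then the third is also nonzero and S_{G(a,b)} S_{G(b,c)} = S_{G(a,c)}; (2) for all (p,q) ∈ G_0×G_0, if one of S_{G(p,q)} and S_{G(q,p)} is nonzero, then the other is also nonzero and S_{G(p,q)} S_{G(q,p)} = S_{G(p)}; (3) for all (p,q) ∈ G_0×G_0, if one of S_{G(p,q)} and S_{G(q,p)} is nonzero, then the other is also nonzero and 1_{S_p} ∈ S_{G(p,q)} S_{G(q,p)}; (4) the family {1_{S_a}}_{a∈G_0} is a strong complete set of idempotents for S. -/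

import Mathlib

open CategoryTheory

namespace ChainPaper

section NonUnital

variable {S : Type*} [NonUnitalRing S]

/-- The additive subgroup `e S f = {e * s * f | s ∈ S}` of a non-unital ring `S`. -/
def corner (e f : S) : AddSubgroup S :=
  ((AddMonoidHom.mulLeft e).comp (AddMonoidHom.mulRight f)).range

/-- The additive subgroup `S e = {s * e | s ∈ S}`. -/
def rightMulRange (e : S) : AddSubgroup S := (AddMonoidHom.mulRight e).range

/-- The additive subgroup `e S = {e * s | s ∈ S}`. -/
def leftMulRange (e : S) : AddSubgroup S := (AddMonoidHom.mulLeft e).range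

/-- The product of two additive subgroups of a ring: the additive subgroup generated by
all products `a * b` with `a ∈ A`, `b ∈ B`. -/
def sMul (A B : AddSubgroup S) : AddSubgroup S :=
  AddSubgroup.closure {x | ∃ a ∈ A, ∃ b ∈ B, x = a * b}

/-- `I` is a left ideal of the (possibly non-unital) subring whose carrier is
the additive subgroup `C` (closed under multiplication). -/
def IsLeftIdealIn (C I : AddSubgroup S) : Prop :=
  I ≤ C ∧ ∀ s ∈ C, ∀ x ∈ I, s * x ∈ I

def IsRightIdealIn (C I : AddSubgroup S) : Prop :=
  I ≤ C ∧ ∀ s ∈ C, ∀ x ∈ I, x * s ∈ I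

/-- `M` is a left `C`-submodule of `H` (both viewed inside the ambient ring `S`,
with `C` acting by left multiplication). -/
def IsLeftSubmoduleIn (C H M : AddSubgroup S) : Prop :=
  M ≤ H ∧ ∀ s ∈ C, ∀ x ∈ M, s * x ∈ M

def IsRightSubmoduleIn (C H M : AddSubgroup S) : Prop :=
  M ≤ H ∧ ∀ s ∈ C, ∀ x ∈ M, x * s ∈ M

/-- The descending chain condition on the subcollection of additive subgroups of `S`
cut out by the predicate `P`. -/
def DCCOn (P : AddSubgroup S → Prop) : Prop :=
  ∀ f : ℕ → AddSubgroup S, (∀ n, P (f n)) → (∀ n, f (n + 1) ≤ f n) →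
    ∃ n, ∀ m, n ≤ m → f m = f n

/-- The ascending chain condition on the subcollection of additive subgroups of `S`
cut out by the predicate `P`. -/
def ACCOn (P : AddSubgroup S → Prop) : Prop :=
  ∀ f : ℕ → AddSubgroup S, (∀ n, P (f n)) → (∀ n, f n ≤ f (n + 1)) →
    ∃ n, ∀ m, n ≤ m → f m = f n

def LeftArtinianOn (C : AddSubgroup S) : Prop := DCCOn (IsLeftIdealIn C)
def RightArtinianOn (C : AddSubgroup S) : Prop := DCCOn (IsRightIdealIn C)
def LeftNoetherianOn (C : AddSubgroup S) : Prop := ACCOn (IsLeftIdealIn C)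
def RightNoetherianOn (C : AddSubgroup S) : Prop := ACCOn (IsRightIdealIn C)

end NonUnital

/-- A possibly non-unital ring is left artinian if its poset of left ideals
satisfies the descending chain condition. -/
def IsLeftArtinian (S : Type*) [NonUnitalRing S] : Prop := LeftArtinianOn (⊤ : AddSubgroup S)
def IsRightArtinian (S : Type*) [NonUnitalRing S] : Prop := RightArtinianOn (⊤ : AddSubgroup S)
def IsLeftNoetherian (S : Type*) [NonUnitalRing S] : Prop := LeftNoetherianOn (⊤ : AddSubgroup S)
def IsRightNoetherian (S : Type*) [NonUnitalRing S] : Prop := RightNoetherianOn (⊤ : AddSubgroup S)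

section NonUnital2

variable {S : Type*} [NonUnitalRing S]

/-- `{e i}_{i ∈ ι}` is a complete set of idempotents for `S`: the `e i` are nonzero
pairwise orthogonal idempotents and `S = ⊕ᵢ S eᵢ = ⊕ᵢ eᵢ S` as internal direct sums of
additive subgroups. -/
structure IsCompleteIdempotents {ι : Type*} (e : ι → S) : Prop where
  ne_zero : ∀ i, e i ≠ 0
  idem : ∀ i, e i * e i = e i
  orthogonal : ∀ i j, i ≠ j → e i * e j = 0
  indep_right : iSupIndep fun i => rightMulRange (e i)
  span_right : (⨆ i, rightMulRange (e i)) = ⊤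
  indep_left : iSupIndep fun i => leftMulRange (e i)
  span_left : (⨆ i, leftMulRange (e i)) = ⊤

/-- A complete set of idempotents is strong if for all `p q`, whenever one of
`eₚ S e_q` and `e_q S eₚ` is nonzero, then the other is nonzero and `eₚ ∈ (eₚ S e_q)(e_q S eₚ)`. -/
def IsStrongIdempotents {ι : Type*} (e : ι → S) : Prop :=
  ∀ p q : ι,
    (corner (e p) (e q) ≠ ⊥ ∨ corner (e q) (e p) ≠ ⊥) →
      corner (e p) (e q) ≠ ⊥ ∧ corner (e q) (e p) ≠ ⊥ ∧
        e p ∈ sMul (corner (e p) (e q)) (corner (e q) (e p))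

/-- `H` is finitely generated as a left module over `C` (inside the ambient ring `S`,
`C` acting by left multiplication). -/
def IsFGLeftModuleIn (C H : AddSubgroup S) : Prop :=
  ∃ F : Finset S, ↑F ⊆ (H : Set S) ∧
    ∀ x ∈ H, x ∈ sInf {M : AddSubgroup S | ↑F ⊆ (M : Set S) ∧ ∀ s ∈ C, ∀ y ∈ M, s * y ∈ M}

def IsFGRightModuleIn (C H : AddSubgroup S) : Prop :=
  ∃ F : Finset S, ↑F ⊆ (H : Set S) ∧
    ∀ x ∈ H, x ∈ sInf {M : AddSubgroup S | ↑F ⊆ (M : Set S) ∧ ∀ s ∈ C, ∀ y ∈ M, y * s ∈ M}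

end NonUnital2

/-- A small category `G` is hom-set strong if for all objects `x y`, whenever one of
`G(x,y)` and `G(y,x)` is nonempty (here `G(x,y)` denotes the set of morphisms `y → x`),
then the other is nonempty and `𝟙 x ∈ G(x,y)G(y,x)`. -/
def HomSetStrong (G : Type*) [Category G] : Prop :=
  ∀ x y : G, (Nonempty (y ⟶ x) ∨ Nonempty (x ⟶ y)) →
    Nonempty (y ⟶ x) ∧ Nonempty (x ⟶ y) ∧ ∃ (g : y ⟶ x) (h : x ⟶ y), h ≫ g = 𝟙 x

/-- An object unital grading of the (possibly non-unital) ring `S` by the small category `G`: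
`S = ⊕_{g ∈ G₁} S_g` with `S_g S_h ⊆ S_{g ∘ h}` for composable morphisms, `S_g S_h = 0` for
non-composable ones, and each `S_a` (`a ∈ G₀`) is unital and nonzero with identity `one a`
acting as claimed. The component at a morphism `g : a ⟶ b` (in Mathlib's arrow direction) is
`comp g`, and products follow the paper's convention `S_g S_h ⊆ S_{gh}` where `gh` denotes
`h ≫ g`. -/
structure ObjectUnitalGrading (G : Type*) [Category G] (S : Type*) [NonUnitalRing S] where
  comp : ∀ {a b : G}, (a ⟶ b) → AddSubgroup S
  indep : iSupIndep fun p : Σ a : G, Σ b : G, a ⟶ b => comp p.2.2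
  span : (⨆ p : Σ a : G, Σ b : G, a ⟶ b, comp p.2.2) = ⊤
  mul_mem : ∀ {a b c : G} (g : b ⟶ c) (h : a ⟶ b) {x y : S},
    x ∈ comp g → y ∈ comp h → x * y ∈ comp (h ≫ g)
  mul_eq_zero : ∀ {a b a' b' : G} (g : a ⟶ b) (h : a' ⟶ b') {x y : S},
    x ∈ comp g → y ∈ comp h → b' ≠ a → x * y = 0
  one : G → S
  one_mem : ∀ a : G, one a ∈ comp (𝟙 a)
  one_ne_zero : ∀ a : G, one a ≠ 0
  one_mul_mem : ∀ {a b : G} (g : a ⟶ b), ∀ x ∈ comp g, one b * x = x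
  mul_one_mem : ∀ {a b : G} (g : a ⟶ b), ∀ x ∈ comp g, x * one a = x

namespace ObjectUnitalGrading

variable {G : Type*} [Category G] {S : Type*} [NonUnitalRing S]

/-- `E.hom a b = S_{G(b,a)}`, the sum of the components of all morphisms `a ⟶ b`. -/
def hom (E : ObjectUnitalGrading G S) (a b : G) : AddSubgroup S :=
  ⨆ g : a ⟶ b, E.comp g

/-- The grading is strong: `S_g S_h = S_{gh}` for all composable `g, h`. -/
def IsStronglyGraded (E : ObjectUnitalGrading G S) : Prop :=
  ∀ {a b c : G} (g : b ⟶ c) (h : a ⟶ b), sMul (E.comp g) (E.comp h) = E.comp (h ≫ g)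

/-- The grading is hom-set strong: for all objects `p q`, whenever one of `S_{G(p,q)}`
and `S_{G(q,p)}` is nonzero, the other is nonzero and `1_{S_p} ∈ S_{G(p,q)} S_{G(q,p)}`. -/
def IsHomSetStronglyGraded (E : ObjectUnitalGrading G S) : Prop :=
  ∀ p q : G, (E.hom q p ≠ ⊥ ∨ E.hom p q ≠ ⊥) →
    E.hom q p ≠ ⊥ ∧ E.hom p q ≠ ⊥ ∧ E.one p ∈ sMul (E.hom q p) (E.hom p q)

end ObjectUnitalGrading

/-- A group `H` is polycyclic-by-finite if it has a finite length subnormal series with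
each factor a finite group or an infinite cyclic group. -/
def IsPolycyclicByFinite (H : Type*) [Group H] : Prop :=
  ∃ (n : ℕ) (c : Fin (n + 1) → Subgroup H),
    c 0 = ⊥ ∧ c (Fin.last n) = ⊤ ∧
      ∀ i : Fin n,
        c i.castSucc ≤ c i.succ ∧
        ∃ _ : ((c i.castSucc).subgroupOf (c i.succ)).Normal,
          Finite ((c i.succ) ⧸ (c i.castSucc).subgroupOf (c i.succ)) ∨
            (Infinite ((c i.succ) ⧸ (c i.castSucc).subgroupOf (c i.succ)) ∧
              IsCyclic ((c i.succ) ⧸ (c i.castSucc).subgroupOf (c i.succ)))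

/-- Data exhibiting the non-unital ring `A` as the category algebra `T[G]`: an additive
isomorphism with the free `T`-module on the set of morphisms of `G`, matching the
multiplication `(t g)(u h) = (t u)(gh)` for composable `g, h` (where `gh = h ≫ g`) and
`(t g)(u h) = 0` otherwise. -/
structure CategoryAlgebraIso (T : Type*) [Ring T] (G : Type*) [Category G]
    (A : Type*) [NonUnitalRing A] where
  equiv : ((Σ a : G, Σ b : G, a ⟶ b) →₀ T) ≃+ A
  mul_single_comp : ∀ {a b c : G} (g : b ⟶ c) (h : a ⟶ b) (t u : T),
    equiv (Finsupp.single ⟨b, c, g⟩ t) * equiv (Finsupp.single ⟨a, b, h⟩ u) =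
      equiv (Finsupp.single ⟨a, c, h ≫ g⟩ (t * u))
  mul_single_ne : ∀ {a b a' b' : G} (g : a ⟶ b) (h : a' ⟶ b') (t u : T), b' ≠ a →
    equiv (Finsupp.single ⟨a, b, g⟩ t) * equiv (Finsupp.single ⟨a', b', h⟩ u) = 0

/-- Data exhibiting the non-unital ring `A` as the skew category algebra `R *_α G`: an
additive isomorphism with the direct sum `⊕_{g ∈ G₁} R_{c(g)}`, matching the multiplication
`(r g)(r' h) = (r · α_g(r')) (gh)` for composable `g, h` (where `gh = h ≫ g`) and
`(r g)(r' h) = 0` otherwise. -/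
structure SkewCategoryAlgebraIso (G : Type*) [Category G]
    [DecidableEq (Σ a : G, Σ b : G, a ⟶ b)]
    (R : G → Type*) [∀ a, Ring (R a)]
    (α : ∀ ⦃a b : G⦄, (a ⟶ b) → (R a →+* R b))
    (A : Type*) [NonUnitalRing A] where
  equiv : (Π₀ p : Σ a : G, Σ b : G, a ⟶ b, R p.2.1) ≃+ A
  mul_single_comp : ∀ {a b c : G} (g : b ⟶ c) (h : a ⟶ b) (r : R c) (r' : R b),
    equiv (DFinsupp.single ⟨b, c, g⟩ r) * equiv (DFinsupp.single ⟨a, b, h⟩ r') =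
      equiv (DFinsupp.single ⟨a, c, h ≫ g⟩ (r * α g r'))
  mul_single_ne : ∀ {a b a' b' : G} (g : a ⟶ b) (h : a' ⟶ b') (r : R b) (r' : R b'),
    b' ≠ a →
      equiv (DFinsupp.single ⟨a, b, g⟩ r) * equiv (DFinsupp.single ⟨a', b', h⟩ r') = 0


section SMul

variable {S : Type*} [NonUnitalRing S]

theorem mul_mem_sMul {A B : AddSubgroup S} {a b : S} (ha : a ∈ A) (hb : b ∈ B) :
    a * b ∈ sMul A B :=
  AddSubgroup.subset_closure ⟨a, ha, b, hb, rfl⟩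

theorem sMul_le {A B C : AddSubgroup S} :
    sMul A B ≤ C ↔ ∀ a ∈ A, ∀ b ∈ B, a * b ∈ C := by
  refine ⟨fun h a ha b hb => h (mul_mem_sMul ha hb), fun h => ?_⟩
  refine (AddSubgroup.closure_le C).2 ?_
  rintro _ ⟨a, ha, b, hb, rfl⟩
  exact h a ha b hb

theorem mul_mem_of_mem_sMul {A B C D : AddSubgroup S} (hBC : ∀ b ∈ B, ∀ c ∈ C, b * c ∈ D)
    {x c : S} (hx : x ∈ sMul A B) (hc : c ∈ C) : x * c ∈ sMul A D := by
  suffices h : sMul A B ≤ (sMul A D).comap (AddMonoidHom.mulRight c) from h hx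
  refine sMul_le.2 fun a ha b hb => ?_
  change a * b * c ∈ sMul A D
  rw [mul_assoc]
  exact mul_mem_sMul ha (hBC b hb c hc)

theorem iSupIndep_rightMulRange {ι : Type*} {e : ι → S} (idem : ∀ i, e i * e i = e i)
    (orth : ∀ i j, i ≠ j → e i * e j = 0) : iSupIndep fun i => rightMulRange (e i) := by
  intro i
  rw [AddSubgroup.disjoint_def]
  rintro _ ⟨s, rfl⟩ hx
  have hle : (⨆ j, ⨆ _ : j ≠ i, rightMulRange (e j)) ≤ (AddMonoidHom.mulRight (e i)).ker := by
    refine iSup₂_le fun j hj => ?_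
    rintro _ ⟨t, rfl⟩
    simp [AddMonoidHom.mem_ker, mul_assoc, orth j i hj]
  simpa [AddMonoidHom.mem_ker, mul_assoc, idem] using hle hx

theorem iSupIndep_leftMulRange {ι : Type*} {e : ι → S} (idem : ∀ i, e i * e i = e i)
    (orth : ∀ i j, i ≠ j → e i * e j = 0) : iSupIndep fun i => leftMulRange (e i) := by
  intro i
  rw [AddSubgroup.disjoint_def]
  rintro _ ⟨s, rfl⟩ hx
  have hle : (⨆ j, ⨆ _ : j ≠ i, leftMulRange (e j)) ≤ (AddMonoidHom.mulLeft (e i)).ker := by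
    refine iSup₂_le fun j hj => ?_
    rintro _ ⟨t, rfl⟩
    simp [AddMonoidHom.mem_ker, ← mul_assoc, orth i j hj.symm]
  simpa [AddMonoidHom.mem_ker, ← mul_assoc, idem] using hle hx

end SMul

namespace ObjectUnitalGrading

variable {G : Type*} [Category G] {S : Type*} [NonUnitalRing S] (E : ObjectUnitalGrading G S)

theorem comp_le_hom {a b : G} (g : a ⟶ b) : E.comp g ≤ E.hom a b :=
  le_iSup (fun g : a ⟶ b => E.comp g) g

theorem one_mem_hom (a : G) : E.one a ∈ E.hom a a :=
  E.comp_le_hom (𝟙 a) (E.one_mem a)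

theorem hom_self_ne_bot (a : G) : E.hom a a ≠ ⊥ := fun h =>
  E.one_ne_zero a ((AddSubgroup.mem_bot).1 (h ▸ E.one_mem_hom a))

theorem one_mul_of_mem_hom {a b : G} {x : S} (hx : x ∈ E.hom a b) : E.one b * x = x := by
  have hle : E.hom a b ≤ (AddMonoidHom.mulLeft (E.one b)).eqLocus (AddMonoidHom.id S) :=
    iSup_le fun g y hy => E.one_mul_mem g y hy
  exact hle hx

theorem mul_one_of_mem_hom {a b : G} {x : S} (hx : x ∈ E.hom a b) : x * E.one a = x := by
  have hle : E.hom a b ≤ (AddMonoidHom.mulRight (E.one a)).eqLocus (AddMonoidHom.id S) :=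
    iSup_le fun g y hy => E.mul_one_mem g y hy
  exact hle hx

theorem mul_mem_hom {a b c : G} {x y : S} (hx : x ∈ E.hom b c) (hy : y ∈ E.hom a b) :
    x * y ∈ E.hom a c := by
  have hcomp : ∀ g : b ⟶ c, ∀ z ∈ E.comp g, z * y ∈ E.hom a c := fun g z hz => by
    have hle : E.hom a b ≤ (E.hom a c).comap (AddMonoidHom.mulLeft z) :=
      iSup_le fun h w hw => E.comp_le_hom _ (E.mul_mem g h hz hw)
    exact hle hy
  have hle : E.hom b c ≤ (E.hom a c).comap (AddMonoidHom.mulRight y) :=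
    iSup_le fun g z hz => hcomp g z hz
  exact hle hx

theorem sMul_hom_le (a b c : G) : sMul (E.hom b a) (E.hom c b) ≤ E.hom c a :=
  sMul_le.2 fun _ hx _ hy => E.mul_mem_hom hx hy

theorem one_mul_one_self (a : G) : E.one a * E.one a = E.one a :=
  E.one_mul_of_mem_hom (E.one_mem_hom a)

theorem one_mul_one_of_ne (a b : G) (h : a ≠ b) : E.one a * E.one b = 0 :=
  E.mul_eq_zero (𝟙 a) (𝟙 b) (E.one_mem a) (E.one_mem b) h.symm

/-- To bound the whole ring it suffices to bound each component. -/
theorem mem_of_forall_comp_le {A : AddSubgroup S}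
    (h : ∀ {a b : G} (g : a ⟶ b), E.comp g ≤ A) (s : S) : s ∈ A := by
  have hle : (⨆ p : Σ a : G, Σ b : G, a ⟶ b, E.comp p.2.2) ≤ A := iSup_le fun p => h p.2.2
  exact hle (E.span ▸ AddSubgroup.mem_top s)

theorem isCompleteIdempotents_one : IsCompleteIdempotents E.one where
  ne_zero := E.one_ne_zero
  idem := E.one_mul_one_self
  orthogonal := E.one_mul_one_of_ne
  indep_right := iSupIndep_rightMulRange E.one_mul_one_self E.one_mul_one_of_ne
  span_right := eq_top_iff.2 fun s _ => E.mem_of_forall_comp_le (fun {a _} g x hx =>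
    le_iSup (fun i => rightMulRange (E.one i)) a ⟨x, E.mul_one_mem g x hx⟩) s
  indep_left := iSupIndep_leftMulRange E.one_mul_one_self E.one_mul_one_of_ne
  span_left := eq_top_iff.2 fun s _ => E.mem_of_forall_comp_le (fun {_ b} g x hx =>
    le_iSup (fun i => leftMulRange (E.one i)) b ⟨x, E.one_mul_mem g x hx⟩) s

theorem corner_one_eq_hom (p q : G) : corner (E.one p) (E.one q) = E.hom q p := by
  apply le_antisymm
  · rintro _ ⟨s, rfl⟩
    change s ∈ (E.hom q p).comap
      ((AddMonoidHom.mulLeft (E.one p)).comp (AddMonoidHom.mulRight (E.one q)))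
    refine E.mem_of_forall_comp_le (fun {a b} g x hx => ?_) s
    change E.one p * (x * E.one q) ∈ E.hom q p
    by_cases ha : q = a
    · subst ha
      rw [E.mul_one_mem g x hx]
      by_cases hb : b = p
      · subst hb
        rw [E.one_mul_mem g x hx]
        exact E.comp_le_hom g hx
      · rw [E.mul_eq_zero (𝟙 p) g (E.one_mem p) hx hb]
        exact zero_mem _
    · rw [E.mul_eq_zero g (𝟙 q) hx (E.one_mem q) ha, mul_zero]
      exact zero_mem _
  · intro x hx
    refine ⟨x, ?_⟩
    change E.one p * (x * E.one q) = x
    rw [E.mul_one_of_mem_hom hx, E.one_mul_of_mem_hom hx]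

theorem sMul_hom_eq_of_one_mem {a b : G} (h : E.one a ∈ sMul (E.hom b a) (E.hom a b)) (c : G) :
    sMul (E.hom b a) (E.hom c b) = E.hom c a := by
  refine le_antisymm (E.sMul_hom_le a b c) fun x hx => ?_
  rw [← E.one_mul_of_mem_hom hx]
  exact mul_mem_of_mem_sMul (fun _ hy _ hz => E.mul_mem_hom hy hz) h hx

theorem isStrongIdempotents_one_iff :
    IsStrongIdempotents E.one ↔ E.IsHomSetStronglyGraded := by
  simp only [IsStrongIdempotents, IsHomSetStronglyGraded, corner_one_eq_hom]

variable {E}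

theorem IsHomSetStronglyGraded.sMul_hom_eq (hE : E.IsHomSetStronglyGraded) {a b : G}
    (hab : E.hom b a ≠ ⊥) (c : G) : sMul (E.hom b a) (E.hom c b) = E.hom c a :=
  E.sMul_hom_eq_of_one_mem (hE a b (.inl hab)).2.2 c

theorem IsHomSetStronglyGraded.hom_ne_bot_symm (hE : E.IsHomSetStronglyGraded) {a b : G}
    (hab : E.hom b a ≠ ⊥) : E.hom a b ≠ ⊥ :=
  (hE a b (.inl hab)).2.1

theorem IsHomSetStronglyGraded.hom_ne_bot_trans (hE : E.IsHomSetStronglyGraded) {a b c : G}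
    (hab : E.hom b a ≠ ⊥) (hbc : E.hom c b ≠ ⊥) : E.hom c a ≠ ⊥ := by
  intro hca
  have hcb := hE.sMul_hom_eq (hE.hom_ne_bot_symm hab) c
  refine hbc (eq_bot_iff.2 (hcb ▸ sMul_le.2 fun x _ y hy => ?_))
  rw [hca, AddSubgroup.mem_bot] at hy
  simp [hy]

end ObjectUnitalGrading

theorem statement_11 {G : Type*} [Category G] (hG : HomSetStrong G)
    {S : Type*} [NonUnitalRing S] (E : ObjectUnitalGrading G S) :
    ((∀ a b c : G,
        ((E.hom b a ≠ ⊥ ∧ E.hom c b ≠ ⊥) ∨ (E.hom b a ≠ ⊥ ∧ E.hom c a ≠ ⊥) ∨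
          (E.hom c b ≠ ⊥ ∧ E.hom c a ≠ ⊥)) →
        E.hom b a ≠ ⊥ ∧ E.hom c b ≠ ⊥ ∧ E.hom c a ≠ ⊥ ∧
          sMul (E.hom b a) (E.hom c b) = E.hom c a) ↔
      (∀ p q : G, (E.hom q p ≠ ⊥ ∨ E.hom p q ≠ ⊥) →
        E.hom q p ≠ ⊥ ∧ E.hom p q ≠ ⊥ ∧
          sMul (E.hom q p) (E.hom p q) = E.hom p p)) ∧
    ((∀ p q : G, (E.hom q p ≠ ⊥ ∨ E.hom p q ≠ ⊥) →
        E.hom q p ≠ ⊥ ∧ E.hom p q ≠ ⊥ ∧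
          sMul (E.hom q p) (E.hom p q) = E.hom p p) ↔ E.IsHomSetStronglyGraded) ∧
    (E.IsHomSetStronglyGraded ↔
      (IsCompleteIdempotents E.one ∧ IsStrongIdempotents E.one)) := by
  have one_mem_of_eq : (∀ p q : G, (E.hom q p ≠ ⊥ ∨ E.hom p q ≠ ⊥) →
      E.hom q p ≠ ⊥ ∧ E.hom p q ≠ ⊥ ∧ sMul (E.hom q p) (E.hom p q) = E.hom p p) →
      E.IsHomSetStronglyGraded := fun h p q hpq =>
    ⟨(h p q hpq).1, (h p q hpq).2.1, (h p q hpq).2.2.symm ▸ E.one_mem_hom p⟩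
  refine ⟨⟨fun h p q hpq => ?_, fun h a b c habc => ?_⟩, ⟨one_mem_of_eq, fun h p q hpq => ?_⟩,
    ⟨fun h => ⟨E.isCompleteIdempotents_one, E.isStrongIdempotents_one_iff.2 h⟩,
      fun h => E.isStrongIdempotents_one_iff.1 h.2⟩⟩
  · have hp := E.hom_self_ne_bot p
    obtain ⟨hqp, hpq', -, heq⟩ := h p q p
      (hpq.elim (fun hqp => .inr (.inl ⟨hqp, hp⟩)) fun hpq => .inr (.inr ⟨hpq, hp⟩))
    exact ⟨hqp, hpq', heq⟩
  · have hE := one_mem_of_eq h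
    rcases habc with ⟨hab, hbc⟩ | ⟨hab, hac⟩ | ⟨hbc, hac⟩
    · exact ⟨hab, hbc, hE.hom_ne_bot_trans hab hbc, hE.sMul_hom_eq hab c⟩
    · exact ⟨hab, hE.hom_ne_bot_trans (hE.hom_ne_bot_symm hab) hac, hac, hE.sMul_hom_eq hab c⟩
    · have hab := hE.hom_ne_bot_trans hac (hE.hom_ne_bot_symm hbc)
      exact ⟨hab, hbc, hac, hE.sMul_hom_eq hab c⟩
  · obtain ⟨hqp, hpq', hone⟩ := h p q hpq
    exact ⟨hqp, hpq', E.sMul_hom_eq_of_one_mem hone p⟩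


end ChainPaper
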